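/- arXiv:1003.5141 — 2 statements merged into one kernel-verified Lean document; each statement's English description precedes it below -/
import Mathlib

section
/- Let K/k be a finite Galois extension with Galois group 𝒢 and let S be a finite 𝒢-set with orbit representatives v_1,…,v_s and stabilizers 𝒢_1,…,𝒢_s. Then the image of the norm map 𝒩 on P_S(K) equals the set of products ∏_{i=1}^s Δ_i(λ_i), where each λ_i ranges over the image N_{K/K^{𝒢_i}}(K^×) of the field norm from K to the fixed field K^{𝒢_i}. That is, Im 𝒩 = { Δ_1(λ_1)⋯Δ_s(λ_s) : λ_i ∈ N_{K/K^{𝒢_i}}(K^×) for i = 1,…,s }. -/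
open scoped BigOperators

namespace ArithToric

section Perm

variable (k K : Type*) [Field k] [Field K] [Algebra k K]
variable (S : Type*) [MulAction (K ≃ₐ[k] K) S]

/-- The Galois action on the twisted permutation module `P_S(K)`: the group of functions
`S → Kˣ` with Galois group action `(g • f) s = g (f (g⁻¹ • s))`. -/
def permTwist : (K ≃ₐ[k] K) →* MulAut (S → Kˣ) where
  toFun g := MulEquiv.arrowCongr (MulAction.toPerm g) (Units.mapEquiv (g : K ≃* K))
  map_one' := by
    refine MulEquiv.ext fun f => ?_
    funext s
    refine Units.ext ?_
    show (1 : K ≃ₐ[k] K) ((f ((MulAction.toPerm (1 : K ≃ₐ[k] K)).symm s) : Kˣ) : K) =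
      ((f s : Kˣ) : K)
    simp
  map_mul' := fun g h => by
    refine MulEquiv.ext fun f => ?_
    funext s
    refine Units.ext ?_
    show (g * h : K ≃ₐ[k] K) ((f ((MulAction.toPerm (g * h : K ≃ₐ[k] K)).symm s) : Kˣ) : K) = _
    have h1 : (MulAction.toPerm (g * h : K ≃ₐ[k] K)).symm s = h⁻¹ • g⁻¹ • s := by
      simp [mul_smul]
    rw [h1]
    rfl

lemma permTwist_apply (g : K ≃ₐ[k] K) (f : S → Kˣ) (s : S) :
    ((permTwist k K S g f s : Kˣ) : K) = g (f (g⁻¹ • s)) := rfl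

end Perm

section NormMap

variable {G : Type*} [Group G] [Fintype G] {Γ : Type*} [CommGroup Γ]

/-- The norm map `𝒩(x) = ∏_{g ∈ G} ρ g x` attached to an action of a finite group. -/
noncomputable def normMap (ρ : G →* MulAut Γ) : Γ →* Γ where
  toFun x := ∏ g : G, ρ g x
  map_one' := by simp
  map_mul' x y := by simp [Finset.prod_mul_distrib]

/-- The subgroup of `G`-fixed elements of `Γ`. -/
def fixedSubgroup (ρ : G →* MulAut Γ) : Subgroup Γ where
  carrier := {x | ∀ g : G, ρ g x = x}
  one_mem' := by simp
  mul_mem' := by intro a b ha hb g; simp [ha g, hb g]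
  inv_mem' := by intro a ha g; simp [ha g]

end NormMap


section Delta

variable (k K : Type*) [Field k] [Field K] [Algebra k K]
variable (S : Type*) [MulAction (K ≃ₐ[k] K) S]

/-- For `λ` a unit of the fixed field `K^{𝒢ᵢ}` of the stabilizer `𝒢ᵢ` of `v i`, the function
`Δᵢ(λ) ∈ P_S(K)` whose value at a point `g • (v i)` of the orbit of `v i` is `g λ` (this is
well defined since `λ` is fixed by `𝒢ᵢ`) and whose value is `1` off the orbit of `v i`. -/
noncomputable def Delta {s : ℕ} (v : Fin s → S) (i : Fin s)
    (lam : (IntermediateField.fixedField (MulAction.stabilizer (K ≃ₐ[k] K) (v i)))ˣ) :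
    S → Kˣ := fun x =>
  letI := Classical.dec (x ∈ MulAction.orbit (K ≃ₐ[k] K) (v i))
  if h : x ∈ MulAction.orbit (K ≃ₐ[k] K) (v i) then
    Units.map (h.choose : K →* K)
      (Units.map ((algebraMap
        (IntermediateField.fixedField (MulAction.stabilizer (K ≃ₐ[k] K) (v i))) K) :
          (IntermediateField.fixedField (MulAction.stabilizer (K ≃ₐ[k] K) (v i))) →* K) lam)
  else 1

end Delta

section Helpers

variable (k K : Type*) [Field k] [Field K] [Algebra k K]
variable (S : Type*) [MulAction (K ≃ₐ[k] K) S]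

lemma Delta_self {s : ℕ} (v : Fin s → S) (i : Fin s)
    (lam : (IntermediateField.fixedField (MulAction.stabilizer (K ≃ₐ[k] K) (v i)))ˣ)
    (g : K ≃ₐ[k] K) :
    ((Delta k K S v i lam (g • v i) : Kˣ) : K) = g ((lam :
      (IntermediateField.fixedField (MulAction.stabilizer (K ≃ₐ[k] K) (v i)))) : K) := by
  have h : g • v i ∈ MulAction.orbit (K ≃ₐ[k] K) (v i) := MulAction.mem_orbit _ _
  unfold Delta
  rw [dif_pos h]
  have hc : h.choose • v i = g • v i := h.choose_spec
  change h.choose (lam.val : K) = g (lam.val : K)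
  have hm : g⁻¹ * h.choose ∈ MulAction.stabilizer (K ≃ₐ[k] K) (v i) := by
    rw [MulAction.mem_stabilizer_iff, mul_smul, hc, inv_smul_smul]
  have h2 := (IntermediateField.mem_fixedField_iff _ _).1 lam.val.2 _ hm
  have h3 := congrArg g h2
  rw [← h3, ← AlgEquiv.mul_apply, mul_inv_cancel_left]

lemma Delta_of_notMem {s : ℕ} (v : Fin s → S) (i : Fin s)
    (lam : (IntermediateField.fixedField (MulAction.stabilizer (K ≃ₐ[k] K) (v i)))ˣ)
    (x : S) (h : x ∉ MulAction.orbit (K ≃ₐ[k] K) (v i)) :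
    Delta k K S v i lam x = 1 := by
  unfold Delta
  rw [dif_neg h]

lemma prod_Delta {s : ℕ} (v : Fin s → S)
    (hsep : ∀ i j, i ≠ j → v i ∉ MulAction.orbit (K ≃ₐ[k] K) (v j))
    (lam : (i : Fin s) → (IntermediateField.fixedField (MulAction.stabilizer (K ≃ₐ[k] K) (v i)))ˣ)
    (i : Fin s) (g : K ≃ₐ[k] K) :
    (((∏ j, Delta k K S v j (lam j)) (g • v i) : Kˣ) : K) = g ((lam i).val : K) := by
  rw [Finset.prod_apply, Finset.prod_eq_single i, Delta_self]
  · intro j _ hj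
    apply Delta_of_notMem
    rw [← MulAction.orbit_eq_iff, MulAction.orbit_smul, MulAction.orbit_eq_iff]
    exact hsep i j hj.symm
  · simp

variable [FiniteDimensional k K]

lemma normMap_coe (f : S → Kˣ) (x : S) :
    ((normMap (permTwist k K S) f x : Kˣ) : K) = ∏ g : K ≃ₐ[k] K, g (f (g⁻¹ • x)) := by
  change (((∏ g : K ≃ₐ[k] K, permTwist k K S g f) x : Kˣ) : K) = _
  rw [Finset.prod_apply, Units.coe_prod]
  rfl

lemma normMap_smul (f : S → Kˣ) (x : S) (g : K ≃ₐ[k] K) :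
    ((normMap (permTwist k K S) f (g • x) : Kˣ) : K) = g (normMap (permTwist k K S) f x : Kˣ) := by
  rw [normMap_coe, normMap_coe, map_prod]
  refine (Fintype.prod_equiv (Equiv.mulLeft g) _ _ fun h => ?_).symm
  simp [mul_smul]

lemma norm_fixed (H : Subgroup (K ≃ₐ[k] K)) [Fintype H] [IsGalois k K] (x : K) :
    ((Algebra.norm (IntermediateField.fixedField H) x : IntermediateField.fixedField H) : K) =
      ∏ h : H, (h : K ≃ₐ[k] K) x := by
  have := Algebra.norm_eq_prod_automorphisms (IntermediateField.fixedField H) x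
  refine this.trans ?_
  refine (Fintype.prod_equiv (IntermediateField.subgroupEquivAlgEquiv H).toEquiv _ _ fun h => ?_).symm
  rfl

lemma normMap_eq_norm [IsGalois k K] (f : S → Kˣ) (x : S) :
    ∃ m : Kˣ, ((normMap (permTwist k K S) f x : Kˣ) : K) =
      (Algebra.norm (IntermediateField.fixedField (MulAction.stabilizer (K ≃ₐ[k] K) x)) (m : K) :
        IntermediateField.fixedField (MulAction.stabilizer (K ≃ₐ[k] K) x)) := by
  classical
  set H := MulAction.stabilizer (K ≃ₐ[k] K) x with hH
  refine ⟨∏ q : (K ≃ₐ[k] K) ⧸ H, Units.map ((q.out⁻¹ : K ≃ₐ[k] K) : K →* K) (f (q.out • x)), ?_⟩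
  rw [norm_fixed, normMap_coe]
  rw [← Fintype.prod_equiv (Equiv.inv (K ≃ₐ[k] K)) (fun g => g⁻¹ (f (g • x))) _ (fun g => by simp)]
  have hbij : Function.Bijective
      (fun p : ((K ≃ₐ[k] K) ⧸ H) × H => p.1.out * (p.2 : K ≃ₐ[k] K)) := by
    constructor
    · rintro ⟨q, h⟩ ⟨q2, h2⟩ heq
      have heq2 : q.out * (h : K ≃ₐ[k] K) = q2.out * (h2 : K ≃ₐ[k] K) := heq
      have hq : q = q2 := by
        have := congrArg (QuotientGroup.mk (s := H)) heq2
        rw [QuotientGroup.mk_mul_of_mem _ h.2, QuotientGroup.mk_mul_of_mem _ h2.2,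
          QuotientGroup.out_eq', QuotientGroup.out_eq'] at this
        exact this
      subst hq
      rw [Subtype.ext (mul_left_cancel heq2)]
    · intro g
      have hg : (QuotientGroup.mk (s := H) g).out⁻¹ * g ∈ H :=
        QuotientGroup.eq.1 (QuotientGroup.out_eq' _)
      exact ⟨(QuotientGroup.mk g, ⟨_, hg⟩), mul_inv_cancel_left _ _⟩
  rw [← Fintype.prod_bijective _ hbij
    (fun p => (p.1.out * p.2)⁻¹ (f ((p.1.out * p.2) • x))) _ (fun p => by rfl)]
  rw [Fintype.prod_prod_type_right]
  refine Fintype.prod_equiv (Equiv.inv H) _ _ fun h => ?_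
  rw [Units.coe_prod, map_prod]
  refine Finset.prod_congr rfl fun q _ => ?_
  have h1 : (h : K ≃ₐ[k] K) • x = x := h.2
  rw [mul_smul, h1, mul_inv_rev]
  rfl

lemma normMap_single [IsGalois k K] (f : S → Kˣ) (x : S)
    (hf : ∀ g : K ≃ₐ[k] K, g • x ≠ x → f (g • x) = 1) :
    ((normMap (permTwist k K S) f x : Kˣ) : K) =
      (Algebra.norm (IntermediateField.fixedField (MulAction.stabilizer (K ≃ₐ[k] K) x)) (f x : K) :
        IntermediateField.fixedField (MulAction.stabilizer (K ≃ₐ[k] K) x)) := by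
  classical
  rw [norm_fixed, normMap_coe]
  have e : ∀ g : K ≃ₐ[k] K, g (f (g⁻¹ • x)) =
      if g ∈ MulAction.stabilizer (K ≃ₐ[k] K) x then g (f x) else 1 := by
    intro g
    split_ifs with h
    · rw [MulAction.mem_stabilizer_iff.1 (inv_mem h)]
    · rw [hf, Units.val_one, map_one]
      intro h2
      exact h (inv_mem_iff.1 (MulAction.mem_stabilizer_iff.2 h2))
  simp_rw [e]
  rw [← Finset.prod_filter]
  exact Finset.prod_subtype _ (by simp) _

end Helpers

/-- Let `K/k` be a finite Galois extension with Galois group `𝒢` and let `S`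
be a finite `𝒢`-set with orbit representatives `v 1, …, v s` and stabilizers `𝒢₁, …, 𝒢ₛ`.
Then the image of the norm map `𝒩` on `P_S(K)` is exactly the set of products
`Δ₁(λ₁) ⋯ Δₛ(λₛ)` where each `λᵢ` ranges over the image of the field norm
`N_{K/K^{𝒢ᵢ}} : K^× → (K^{𝒢ᵢ})^×`. -/
theorem norm_image_eq_prod_delta
    (k K : Type*) [Field k] [Field K] [Algebra k K] [FiniteDimensional k K] [IsGalois k K]
    (S : Type*) [Fintype S] [MulAction (K ≃ₐ[k] K) S]
    {s : ℕ} (v : Fin s → S)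
    (hcover : ∀ x : S, ∃ i, x ∈ MulAction.orbit (K ≃ₐ[k] K) (v i))
    (hsep : ∀ i j, i ≠ j → v i ∉ MulAction.orbit (K ≃ₐ[k] K) (v j)) :
    Set.range (normMap (permTwist k K S)) =
      {f | ∃ lam : (i : Fin s) →
          (IntermediateField.fixedField (MulAction.stabilizer (K ≃ₐ[k] K) (v i)))ˣ,
        (∀ i, lam i ∈ Set.range (Units.map
          (Algebra.norm (IntermediateField.fixedField (MulAction.stabilizer (K ≃ₐ[k] K) (v i))) :
            K →* (IntermediateField.fixedField (MulAction.stabilizer (K ≃ₐ[k] K) (v i)))))) ∧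
        f = ∏ i, Delta k K S v i (lam i)} := by
  classical
  have key : ∀ (f : S → Kˣ) (lam : (i : Fin s) →
      (IntermediateField.fixedField (MulAction.stabilizer (K ≃ₐ[k] K) (v i)))ˣ),
      (∀ i, ((normMap (permTwist k K S) f (v i) : Kˣ) : K) = ((lam i).val : K)) →
      normMap (permTwist k K S) f = ∏ i, Delta k K S v i (lam i) := by
    intro f lam h
    funext x
    obtain ⟨i, g, rfl⟩ := hcover x
    apply Units.ext
    change ((normMap (permTwist k K S) f (g • v i) : Kˣ) : K) =
      (((∏ j, Delta k K S v j (lam j)) (g • v i) : Kˣ) : K)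
    rw [prod_Delta k K S v hsep, normMap_smul, h]
  ext F
  constructor
  · rintro ⟨f, rfl⟩
    choose m hm using fun i => normMap_eq_norm k K S f (v i)
    exact ⟨fun i => Units.map (Algebra.norm _) (m i), fun i => ⟨m i, rfl⟩, key f _ hm⟩
  · rintro ⟨lam, hlam, rfl⟩
    choose m hm using hlam
    have hinj : Function.Injective v := by
      intro i j hij
      by_contra hne
      exact hsep i j hne (hij ▸ MulAction.mem_orbit_self _)
    have hf : ∀ i, Function.extend v m 1 (v i) = m i := fun i => hinj.extend_apply m 1 i
    refine ⟨Function.extend v m 1, key _ _ fun i => ?_⟩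
    rw [normMap_single, hf, ← hm i]
    · rfl
    · intro g hg
      by_cases hx : ∃ j, v j = g • v i
      · obtain ⟨j, hj⟩ := hx
        have hji : j ≠ i := by
          rintro rfl
          exact hg hj.symm
        exact absurd (hj ▸ MulAction.mem_orbit _ _) (hsep j i hji)
      · rw [Function.extend_apply' _ _ _ hx]
        rfl

end ArithToric
end

section
/- Let K/k be a cyclic Galois extension of degree d with Galois group 𝒢 = ⟨ξ⟩, let n ≥ 1 and S = {0,1,…,n}, and suppose 𝒢 acts on S with orbits O_1,…,O_s of sizes m_1,…,m_s (so each m_i divides d and the stabilizer of every point of O_i is the subgroup ⟨ξ^{m_i}⟩). Let Q(K) = P_S(K)/Δ(K^×) be the quotient of the twisted permutation module P_S(K) by the subgroup of constant functions, with the induced 𝒢-action. Then there is an isomorphism of groups H^1(𝒢, Q(K)) ≅ ( k^× ∩ ⋂_{i=1}^s N_{K/K^{⟨ξ^{m_i}⟩}}(K^×) ) / N_{K/k}(K^×). -/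
open scoped BigOperators

namespace ArithToric

section H1

variable {G : Type*} [Group G] {Γ : Type*} [CommGroup Γ]

/-- The 1-cocycles of `G` with values in `Γ`, where `G` acts on `Γ` via `ρ`:
maps `c` with `c (g * h) = c g * ρ g (c h)`. -/
def cocycles (ρ : G →* MulAut Γ) : Subgroup (G → Γ) where
  carrier := {c | ∀ g h, c (g * h) = c g * ρ g (c h)}
  one_mem' := by intro g h; simp
  mul_mem' := by
    intro c c' hc hc' g h
    simp only [Pi.mul_apply, hc g h, hc' g h, map_mul]
    exact mul_mul_mul_comm _ _ _ _
  inv_mem' := by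
    intro c hc g h
    simp [Pi.inv_apply, hc g h, mul_inv, map_inv, mul_comm]

/-- The 1-coboundaries: maps of the form `g ↦ b⁻¹ * ρ g b`. -/
def coboundaries (ρ : G →* MulAut Γ) : Subgroup (G → Γ) where
  carrier := {c | ∃ b : Γ, ∀ g, c g = b⁻¹ * ρ g b}
  one_mem' := ⟨1, by simp⟩
  mul_mem' := by
    rintro c c' ⟨b, hb⟩ ⟨b', hb'⟩
    refine ⟨b * b', fun g => ?_⟩
    simp only [Pi.mul_apply, hb g, hb' g, map_mul, mul_inv]
    exact mul_mul_mul_comm _ _ _ _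
  inv_mem' := by
    rintro c ⟨b, hb⟩
    exact ⟨b⁻¹, fun g => by simp [hb g, mul_inv, map_inv, mul_comm]⟩

/-- First group cohomology `H¹(G, Γ)` for the action `ρ`, defined as
1-cocycles modulo 1-coboundaries. -/
def H1 (ρ : G →* MulAut Γ) :=
  cocycles ρ ⧸ ((coboundaries ρ).subgroupOf (cocycles ρ))

noncomputable instance (ρ : G →* MulAut Γ) : CommGroup (H1 ρ) := by
  unfold H1; infer_instance

end H1


section QuotConst

variable (k K : Type*) [Field k] [Field K] [Algebra k K]
variable (S : Type*) [MulAction (K ≃ₐ[k] K) S]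

/-- The subgroup `Δ(K^×)` of constant functions in `P_S(K)`. -/
def constSubgroup : Subgroup (S → Kˣ) :=
  MonoidHom.range { toFun := fun (u : Kˣ) (_ : S) => u,
                    map_one' := rfl, map_mul' := fun _ _ => rfl }

lemma map_constSubgroup (g : K ≃ₐ[k] K) :
    (constSubgroup K S).map (permTwist k K S g : (S → Kˣ) →* (S → Kˣ)) = constSubgroup K S := by
  ext f
  constructor
  · rintro ⟨c, ⟨u, rfl⟩, rfl⟩
    exact ⟨Units.mapEquiv (g : K ≃* K) u, rfl⟩
  · rintro ⟨u, rfl⟩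
    exact ⟨_, ⟨Units.mapEquiv (g : K ≃* K).symm u, rfl⟩,
      funext fun s => Units.ext (by
        show (g : K ≃* K) ((Units.mapEquiv (g : K ≃* K).symm u : Kˣ) : K) = (u : K)
        show (g : K ≃* K) (((g : K ≃* K).symm (u : K))) = (u : K)
        exact (g : K ≃* K).apply_symm_apply _)⟩

/-- The induced Galois action on the quotient `Q(K) = P_S(K)/Δ(K^×)`. -/
def quotAction : (K ≃ₐ[k] K) →* MulAut ((S → Kˣ) ⧸ constSubgroup K S) where
  toFun g := QuotientGroup.congr _ _ (permTwist k K S g) (map_constSubgroup k K S g)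
  map_one' := by
    refine MulEquiv.ext fun q => ?_
    induction q using QuotientGroup.induction_on with
    | H f =>
      show QuotientGroup.mk (permTwist k K S 1 f) = _
      rw [map_one]
      rfl
  map_mul' := fun g h => by
    refine MulEquiv.ext fun q => ?_
    induction q using QuotientGroup.induction_on with
    | H f =>
      show QuotientGroup.mk (permTwist k K S (g * h) f) = _
      rw [map_mul]
      rfl

end QuotConst


section ProjSpace

variable (k K : Type*) [Field k] [Field K] [Algebra k K]

/-- The subgroup of `k^×` of elements which are norms from `K^×` to the fixed field
`K^⟨ξʲ⟩` (comparison taking place inside `K`): this is `k^× ∩ N_{K/K^⟨ξʲ⟩}(K^×)`. -/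
noncomputable def normFromFixedField (ξ : K ≃ₐ[k] K) (j : ℕ) : Subgroup kˣ :=
  Subgroup.comap (Units.map ((algebraMap k K) : k →* K))
    ((Units.map ((algebraMap (IntermediateField.fixedField (Subgroup.zpowers (ξ ^ j))) K) :
        (IntermediateField.fixedField (Subgroup.zpowers (ξ ^ j))) →* K)).comp
      (Units.map (Algebra.norm (IntermediateField.fixedField (Subgroup.zpowers (ξ ^ j))) :
        K →* (IntermediateField.fixedField (Subgroup.zpowers (ξ ^ j)))))).range

/-- The subgroup `k^× ∩ ⋂ᵢ N_{K/K^⟨ξ^{mᵢ}⟩}(K^×)` of `k^×`. -/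
noncomputable def interNorms (ξ : K ≃ₐ[k] K) {s : ℕ} (m : Fin s → ℕ) : Subgroup kˣ :=
  ⨅ i : Fin s, normFromFixedField k K ξ (m i)

end ProjSpace

section Helpers

section Generic

variable {G : Type*} [Group G] {Γ : Type*} [CommGroup Γ]

lemma map_mul_apply' (ρ : G →* MulAut Γ) (g h : G) (x : Γ) : ρ (g * h) x = ρ g (ρ h x) := by
  rw [map_mul]; rfl

lemma cocycle_one {ρ : G →* MulAut Γ} {c : G → Γ} (hc : c ∈ cocycles ρ) : c 1 = 1 := by
  have h := hc 1 1
  simpa using h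

lemma cocycle_pow {ρ : G →* MulAut Γ} {c : G → Γ} (hc : c ∈ cocycles ρ) (ξ : G) (j : ℕ) :
    c (ξ ^ j) = ∏ i ∈ Finset.range j, ρ (ξ ^ i) (c ξ) := by
  induction j with
  | zero => simpa using cocycle_one hc
  | succ j ih => rw [Finset.prod_range_succ, ← ih, pow_succ, hc]

lemma exists_pow [Finite G] {ξ : G} (hgen : ∀ g : G, g ∈ Subgroup.zpowers ξ) (g : G) :
    ∃ j : ℕ, ξ ^ j = g := by
  have h := hgen g
  rw [← mem_powers_iff_mem_zpowers] at h
  exact h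

lemma cocycle_ext [Finite G] {ρ : G →* MulAut Γ} {c c' : G → Γ} (hc : c ∈ cocycles ρ)
    (hc' : c' ∈ cocycles ρ) {ξ : G} (hgen : ∀ g : G, g ∈ Subgroup.zpowers ξ)
    (h : c ξ = c' ξ) : c = c' := by
  funext g
  obtain ⟨j, rfl⟩ := exists_pow hgen g
  rw [cocycle_pow hc, cocycle_pow hc', h]

lemma prod_range_eq_prod_univ [Fintype G] {M : Type*} [CommMonoid M] {ξ : G}
    (hgen : ∀ g : G, g ∈ Subgroup.zpowers ξ) (F : G → M) :
    ∏ i ∈ Finset.range (orderOf ξ), F (ξ ^ i) = ∏ g, F g := by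
  classical
  rw [← IsCyclic.image_range_orderOf hgen, Finset.prod_image]
  intro i hi j hj hij
  exact pow_injOn_Iio_orderOf (by simpa using hi) (by simpa using hj) hij

lemma cocycle_norm [Fintype G] {ρ : G →* MulAut Γ} {c : G → Γ} (hc : c ∈ cocycles ρ) {ξ : G}
    (hgen : ∀ g : G, g ∈ Subgroup.zpowers ξ) : ∏ g, ρ g (c ξ) = 1 := by
  rw [← prod_range_eq_prod_univ hgen (fun g => ρ g (c ξ)), ← cocycle_pow hc, pow_orderOf_eq_one,
    cocycle_one hc]

lemma coboundary_mem (ρ : G →* MulAut Γ) (b : Γ) : (fun g => b⁻¹ * ρ g b) ∈ cocycles ρ := by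
  intro g h
  show b⁻¹ * ρ (g * h) b = b⁻¹ * ρ g b * ρ g (b⁻¹ * ρ h b)
  rw [map_mul_apply', map_mul, map_inv]
  group

lemma exists_cocycle [Fintype G] (ρ : G →* MulAut Γ) {ξ : G}
    (hgen : ∀ g : G, g ∈ Subgroup.zpowers ξ) (x : Γ) (hx : ∏ g, ρ g x = 1) :
    ∃ c ∈ cocycles ρ, c ξ = x := by
  let T : ℕ → Γ := fun j => ∏ i ∈ Finset.range j, ρ (ξ ^ i) x
  have hadd : ∀ i j, T (i + j) = T i * ρ (ξ ^ i) (T j) := by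
    intro i j
    simp only [T, Finset.prod_range_add, map_prod, pow_add, map_mul_apply']
  have hd : T (orderOf ξ) = 1 := by
    simp only [T]
    rw [prod_range_eq_prod_univ hgen (fun g => ρ g x), hx]
  have hmul : ∀ q, T (orderOf ξ * q) = 1 := by
    intro q
    induction q with
    | zero => simp [T]
    | succ q ih => rw [mul_add, hadd, ih, mul_one, hd]; simp
  have hmod : ∀ j, T j = T (j % orderOf ξ) := by
    intro j
    conv_lhs => rw [← Nat.div_add_mod j (orderOf ξ)]
    rw [hadd, hmul, pow_mul, pow_orderOf_eq_one]
    simp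
  have hwd : ∀ i j, ξ ^ i = ξ ^ j → T i = T j := by
    intro i j hij
    rw [pow_inj_mod] at hij
    rw [hmod i, hmod j, hij]
  choose e he using exists_pow hgen
  refine ⟨fun g => T (e g), ?_, ?_⟩
  · intro g h
    show T (e (g * h)) = T (e g) * ρ g (T (e h))
    have : ρ g = ρ (ξ ^ e g) := by rw [he]
    rw [this, ← hadd]
    apply hwd
    rw [he, pow_add, he, he]
  · show T (e ξ) = x
    rw [hwd (e ξ) 1 (by rw [he, pow_one])]
    simp [T]

lemma prod_coset [Fintype G] {M : Type*} [CommMonoid M] (H : Subgroup G) [Fintype H]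
    [Fintype (G ⧸ H)] (F : G → M) : ∏ g, F g = ∏ h : H, ∏ q : G ⧸ H, F (q.out * h) := by
  rw [Finset.prod_comm, ← Fintype.prod_prod_type']
  symm
  apply Fintype.prod_bijective (fun p : (G ⧸ H) × H => p.1.out * (p.2 : G)) ?_ _ _ (fun _ => rfl)
  constructor
  · rintro ⟨q, h⟩ ⟨q', h'⟩ heq
    have h1 : ∀ (q : G ⧸ H) (h : H), ((q.out * (h : G) : G) : G ⧸ H) = q := by
      intro q h
      rw [QuotientGroup.mk_mul_of_mem _ h.2, QuotientGroup.out_eq']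
    have hq : q = q' := by
      rw [← h1 q h, ← h1 q' h']
      exact congrArg _ heq
    subst hq
    simpa using heq
  · intro g
    refine ⟨((g : G ⧸ H), ⟨(g : G ⧸ H).out⁻¹ * g, ?_⟩), by simp⟩
    rw [← QuotientGroup.eq, QuotientGroup.out_eq']

lemma nonempty_equiv_of_ker_eq {M A B : Type*} [Group M] [Group A] [Group B] (f : M →* A)
    (g : M →* B) (hf : Function.Surjective f) (hg : Function.Surjective g) (h : f.ker = g.ker) :
    Nonempty (A ≃* B) :=
  ⟨(QuotientGroup.quotientKerEquivOfSurjective f hf).symm.trans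
    ((QuotientGroup.quotientMulEquivOfEq h).trans
      (QuotientGroup.quotientKerEquivOfSurjective g hg))⟩

end Generic

section Fields

variable {k K : Type*} [Field k] [Field K] [Algebra k K] [FiniteDimensional k K] [IsGalois k K]

lemma norm_fixedField (H : Subgroup (K ≃ₐ[k] K)) [Fintype H] (x : K) :
    ((Algebra.norm (IntermediateField.fixedField H) x : IntermediateField.fixedField H) : K) =
      ∏ h : H, (h : K ≃ₐ[k] K) x := by
  have h1 := Algebra.norm_eq_prod_automorphisms (IntermediateField.fixedField H) x
  refine h1.trans ?_
  symm
  let e : H ≃ (K ≃ₐ[IntermediateField.fixedField H] K) :=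
    (MulEquiv.subgroupCongr (IntermediateField.fixingSubgroup_fixedField H).symm).toEquiv.trans
      (IntermediateField.fixingSubgroupEquiv (IntermediateField.fixedField H)).toEquiv
  exact Fintype.prod_equiv e _ _ (fun _ => rfl)

lemma exists_base (x : Kˣ) (h : ∀ g : K ≃ₐ[k] K, g (x : K) = x) :
    ∃ l : kˣ, Units.map ((algebraMap k K) : k →* K) l = x := by
  obtain ⟨y, hy⟩ := (IsGalois.mem_bot_iff_fixed (F := k) (E := K) (x : K)).2 h
  have hy' : algebraMap k K y = x := hy
  have : y ≠ 0 := by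
    rintro rfl
    exact x.ne_zero (by rw [← hy', map_zero])
  exact ⟨Units.mk0 y this, Units.ext hy'⟩

variable {S : Type*} [MulAction (K ≃ₐ[k] K) S]

/-- Constant functions. -/
def constHom (K S : Type*) [Field K] : Kˣ →* (S → Kˣ) where
  toFun := fun u _ => u
  map_one' := rfl
  map_mul' := fun _ _ => rfl

/-- Norm of an element of the permutation module. -/
noncomputable def pnorm (k K S : Type*) [Field k] [Field K] [Algebra k K] [FiniteDimensional k K]
    [MulAction (K ≃ₐ[k] K) S] : (S → Kˣ) →* (S → Kˣ) where
  toFun f := ∏ g : K ≃ₐ[k] K, permTwist k K S g f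
  map_one' := by simp
  map_mul' f f' := by simp [Finset.prod_mul_distrib]

lemma pnorm_apply (f : S → Kˣ) (s : S) :
    ((pnorm k K S f s : Kˣ) : K) = ∏ g : K ≃ₐ[k] K, g (f (g⁻¹ • s)) := by
  show (((∏ g : K ≃ₐ[k] K, permTwist k K S g f) s : Kˣ) : K) = _
  rw [Finset.prod_apply, Units.coe_prod]
  rfl

lemma permTwist_pnorm (g : K ≃ₐ[k] K) (f : S → Kˣ) :
    permTwist k K S g (pnorm k K S f) = pnorm k K S f := by
  show permTwist k K S g (∏ h : K ≃ₐ[k] K, permTwist k K S h f) = ∏ h : K ≃ₐ[k] K, permTwist k K S h f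
  rw [map_prod]
  refine Fintype.prod_equiv (Equiv.mulLeft g) _ _ (fun h => ?_)
  simp only [Equiv.coe_mulLeft, map_mul_apply']

lemma pnorm_permTwist (g : K ≃ₐ[k] K) (f : S → Kˣ) :
    pnorm k K S (permTwist k K S g f) = pnorm k K S f := by
  show (∏ h : K ≃ₐ[k] K, permTwist k K S h (permTwist k K S g f)) = ∏ h : K ≃ₐ[k] K, permTwist k K S h f
  refine Fintype.prod_equiv (Equiv.mulRight g) _ _ (fun h => ?_)
  simp only [Equiv.coe_mulRight, map_mul_apply']

lemma pnorm_const (u : Kˣ) : pnorm k K S (constHom K S u) =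
    constHom K S (Units.map ((algebraMap k K) : k →* K) (Units.map (Algebra.norm k : K →* k) u)) := by
  funext s
  ext
  rw [pnorm_apply]
  exact (Algebra.norm_eq_prod_automorphisms k (u : K)).symm

/-- Value of the norm at a point is a norm from the fixed field of the stabilizer. -/
lemma pnorm_apply_stab (f : S → Kˣ) (s : S) (H : Subgroup (K ≃ₐ[k] K))
    (hH : ∀ h ∈ H, h • s = s) :
    ∃ a : Kˣ, ((pnorm k K S f s : Kˣ) : K) =
      ((Algebra.norm (IntermediateField.fixedField H) (a : K) : IntermediateField.fixedField H) : K) := by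
  classical
  refine ⟨∏ q : (K ≃ₐ[k] K) ⧸ H, Units.mapEquiv ((q.out⁻¹ : K ≃ₐ[k] K) : K ≃* K) (f (q.out • s)), ?_⟩
  rw [pnorm_apply, norm_fixedField, ← Equiv.prod_comp (Equiv.inv (K ≃ₐ[k] K)), prod_coset H,
    ← Equiv.prod_comp (Equiv.inv H)]
  refine Finset.prod_congr rfl fun h _ => ?_
  rw [Units.coe_prod, map_prod]
  refine Finset.prod_congr rfl fun q _ => ?_
  have h1 : ((h⁻¹ : H) : K ≃ₐ[k] K) • s = s := hH _ (h⁻¹).2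
  simp only [Equiv.inv_apply, mul_inv_rev, inv_inv, mul_smul, h1]
  simp
  rfl

lemma pnorm_extend {f : S → Kˣ} {s : S} (H : Subgroup (K ≃ₐ[k] K))
    (hH : MulAction.stabilizer (K ≃ₐ[k] K) s = H)
    (hf : ∀ g : K ≃ₐ[k] K, g • s ≠ s → f (g • s) = 1) :
    ((pnorm k K S f s : Kˣ) : K) =
      ((Algebra.norm (IntermediateField.fixedField H) (f s : K) : IntermediateField.fixedField H) : K) := by
  classical
  rw [pnorm_apply, norm_fixedField, ← Finset.prod_subtype (Finset.univ.filter (· ∈ H))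
    (by simp) (fun g : K ≃ₐ[k] K => g (f s : K)), Finset.prod_filter]
  refine Finset.prod_congr rfl fun g _ => ?_
  subst hH
  split_ifs with h
  · have h2 : g⁻¹ • s = s := (inv_mem h : g⁻¹ ∈ MulAction.stabilizer (K ≃ₐ[k] K) s)
    rw [h2]
  · rw [hf]
    · simp
    · intro h2
      exact h (by simpa using inv_mem (show g⁻¹ ∈ MulAction.stabilizer (K ≃ₐ[k] K) s from h2))

/-- Hilbert 90 for permutation modules. -/
lemma perm_hilbert90 {ι : Type*} (v : ι → S)
    (hcover : ∀ x, ∃ i, x ∈ MulAction.orbit (K ≃ₐ[k] K) (v i))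
    (hsep : ∀ i j, i ≠ j → v i ∉ MulAction.orbit (K ≃ₐ[k] K) (v j))
    (c : (K ≃ₐ[k] K) → (S → Kˣ)) (hc : c ∈ cocycles (permTwist k K S)) :
    ∃ b : S → Kˣ, ∀ g, c g = b⁻¹ * permTwist k K S g b := by
  classical
  have hc' : ∀ (g h : K ≃ₐ[k] K) (s : S), ((c (g * h) s : Kˣ) : K) =
      c g s * g (c h (g⁻¹ • s)) := by
    intro g h s
    rw [hc g h]
    rfl
  have hone : c 1 = 1 := cocycle_one hc
  -- nonvanishing
  have hex : ∀ i, ∃ a : K, ∑ h : K ≃ₐ[k] K,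
      (if h⁻¹ • v i = v i then ((c h (v i) : Kˣ) : K) else 0) * h a ≠ 0 := by
    intro i
    by_contra hcon
    push Not at hcon
    have hli : LinearIndependent K (fun g : K ≃ₐ[k] K => (g : K → K)) :=
      (linearIndependent_monoidHom K K).comp (fun g : K ≃ₐ[k] K => (g : K →* K))
        (fun g g' hgg => AlgEquiv.ext fun x => DFunLike.congr_fun hgg x)
    have := Fintype.linearIndependent_iff.1 hli
      (fun h => if h⁻¹ • v i = v i then ((c h (v i) : Kˣ) : K) else 0)
      (by funext a; exact (Finset.sum_apply _ _ _).trans (hcon a)) 1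
    simp [hone] at this
  choose a ha using hex
  have hinj : Function.Injective v := by
    intro i j hij
    by_contra hne
    exact hsep i j hne (hij ▸ MulAction.mem_orbit_self _)
  let A : S → K := fun x => if h : ∃ i, v i = x then a h.choose else 0
  have hA : ∀ i, A (v i) = a i := by
    intro i
    have hx : ∃ j, v j = v i := ⟨i, rfl⟩
    simp only [A, dif_pos hx]
    rw [hinj hx.choose_spec]
  have hA0 : ∀ i (g : K ≃ₐ[k] K), g • v i ≠ v i → A (g • v i) = 0 := by
    intro i g hg
    refine dif_neg ?_
    rintro ⟨j, hj⟩
    by_cases hij : j = i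
    · subst hij
      exact hg hj.symm
    · exact hsep j i hij (hj ▸ MulAction.mem_orbit _ _)
  let b : S → K := fun s => ∑ h : K ≃ₐ[k] K, (c h s : K) * h (A (h⁻¹ • s))
  have hb : ∀ (g : K ≃ₐ[k] K) s, (c g s : K) * g (b (g⁻¹ • s)) = b s := by
    intro g s
    simp only [b]
    rw [map_sum, Finset.mul_sum]
    refine Fintype.sum_equiv (Equiv.mulLeft g) _ _ (fun h => ?_)
    simp only [Equiv.coe_mulLeft, hc', map_mul, mul_inv_rev, mul_smul, AlgEquiv.mul_apply, mul_assoc]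
  have hbv : ∀ i, b (v i) ≠ 0 := by
    intro i
    convert ha i using 1
    refine Finset.sum_congr rfl fun h _ => ?_
    split_ifs with hh
    · rw [hh, hA]
    · rw [hA0 _ _ hh]; simp
  have hb0 : ∀ s, b s ≠ 0 := by
    intro s
    obtain ⟨i, g, rfl⟩ := hcover s
    show b (g • v i) ≠ 0
    rw [← hb g]
    simpa using hbv i
  refine ⟨fun s => (Units.mk0 (b s) (hb0 s))⁻¹, fun g => ?_⟩
  funext s
  ext
  show (c g s : K) = _
  have h1 := hb g s
  have h2 : ((((fun s => (Units.mk0 (b s) (hb0 s))⁻¹)⁻¹ * permTwist k K S g fun s => (Units.mk0 (b s) (hb0 s))⁻¹) s : Kˣ) : K)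
    = b s * g ((b (g⁻¹ • s))⁻¹) := by
    rw [Pi.mul_apply, Units.val_mul, permTwist_apply]
    simp
  rw [h2, ← h1, map_inv₀, mul_assoc, mul_inv_cancel₀, mul_one]
  simpa using hb0 _


lemma mem_normFromFixedField (ξ : K ≃ₐ[k] K) (j : ℕ) (l : kˣ) :
    l ∈ normFromFixedField k K ξ j ↔ ∃ a : Kˣ,
      ((Algebra.norm (IntermediateField.fixedField (Subgroup.zpowers (ξ ^ j))) (a : K) :
        IntermediateField.fixedField (Subgroup.zpowers (ξ ^ j))) : K) = algebraMap k K l := by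
  constructor
  · rintro ⟨a, ha⟩
    exact ⟨a, congrArg Units.val ha⟩
  · rintro ⟨a, ha⟩
    exact ⟨a, Units.ext ha⟩

/-- The projection from cocycles to cohomology. -/
noncomputable def H1mk {G Γ : Type*} [Group G] [CommGroup Γ] (ρ : G →* MulAut Γ) :
    cocycles ρ →* H1 ρ :=
  QuotientGroup.mk' ((coboundaries ρ).subgroupOf (cocycles ρ))

lemma H1mk_surjective {G Γ : Type*} [Group G] [CommGroup Γ] (ρ : G →* MulAut Γ) :
    Function.Surjective (H1mk ρ) :=
  QuotientGroup.mk'_surjective ((coboundaries ρ).subgroupOf (cocycles ρ))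

lemma H1mk_eq_one {G Γ : Type*} [Group G] [CommGroup Γ] (ρ : G →* MulAut Γ) (c : cocycles ρ) :
    H1mk ρ c = 1 ↔ (c : G → Γ) ∈ coboundaries ρ :=
  (QuotientGroup.eq_one_iff (N := (coboundaries ρ).subgroupOf (cocycles ρ)) c).trans
    Subgroup.mem_subgroupOf

/-- Type of actions on a commutative group. -/
abbrev CAct (G Γ : Type*) [Group G] [CommGroup Γ] := G →* MulAut Γ

/-- The action on the quotient, with the commutative group structure. -/
abbrev qAct (k K S : Type*) [Field k] [Field K] [Algebra k K] [MulAction (K ≃ₐ[k] K) S] :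
    @CAct (K ≃ₐ[k] K) ((S → Kˣ) ⧸ constSubgroup K S) _ (QuotientGroup.Quotient.commGroup _) :=
  quotAction k K S

/-- The auxiliary group of triples (cocycle, lift of its value at the generator, scalar). -/
noncomputable def tripleGroup (S : Type*) [MulAction (K ≃ₐ[k] K) S] (ξ : K ≃ₐ[k] K) :
    Subgroup ((cocycles (qAct k K S)) × (S → Kˣ) × kˣ) where
  carrier := {x | x.1.1 ξ = QuotientGroup.mk x.2.1 ∧
    pnorm k K S x.2.1 = constHom K S (Units.map ((algebraMap k K) : k →* K) x.2.2)}
  one_mem' := ⟨rfl, by simp⟩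
  mul_mem' := by
    rintro x y ⟨hx1, hx2⟩ ⟨hy1, hy2⟩
    refine ⟨?_, ?_⟩
    · show x.1.1 ξ * y.1.1 ξ = _
      rw [hx1, hy1]
      rfl
    · show pnorm k K S (x.2.1 * y.2.1) = constHom K S (Units.map _ (x.2.2 * y.2.2))
      rw [map_mul, map_mul, map_mul, hx2, hy2]
  inv_mem' := by
    rintro x ⟨hx1, hx2⟩
    refine ⟨?_, ?_⟩
    · show (x.1.1 ξ)⁻¹ = _
      rw [hx1]
      rfl
    · show pnorm k K S (x.2.1⁻¹) = constHom K S (Units.map _ (x.2.2⁻¹))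
      rw [map_inv, map_inv, map_inv, hx2]

lemma mk_prod (f : S → Kˣ) : (∏ g : K ≃ₐ[k] K, qAct k K S g (QuotientGroup.mk f)) =
    ((pnorm k K S f : S → Kˣ) : (S → Kˣ) ⧸ constSubgroup K S) := by
  show _ = QuotientGroup.mk' (constSubgroup K S) (∏ g : K ≃ₐ[k] K, permTwist k K S g f)
  rw [map_prod]
  rfl

lemma mk_eq_one_iff (f : S → Kˣ) :
    (f : (S → Kˣ) ⧸ constSubgroup K S) = 1 ↔ ∃ u, constHom K S u = f :=
  QuotientGroup.eq_one_iff f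

lemma constHom_inj [Nonempty S] {u u' : Kˣ} (h : constHom K S u = constHom K S u') : u = u' :=
  congrFun h (Classical.arbitrary S)

lemma pnorm_const_base [Nonempty S] {f : S → Kˣ} {u : Kˣ} (h : constHom K S u = pnorm k K S f) :
    ∃ l : kˣ, pnorm k K S f = constHom K S (Units.map ((algebraMap k K) : k →* K) l) := by
  obtain ⟨l, hl⟩ := exists_base (k := k) u (fun g => by
    have h1 := permTwist_pnorm g f
    rw [← h] at h1
    exact congrArg Units.val (congrFun h1 (Classical.arbitrary S)))
  exact ⟨l, by rw [hl, h]⟩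

end Fields

end Helpers

/-- Let `K/k` be a cyclic Galois extension of degree `d` with Galois group
`𝒢 = ⟨ξ⟩` acting on `S = {0,…,n}` with orbits `O₁,…,Oₛ` of sizes `m₁,…,mₛ` (each `mᵢ ∣ d`,
the stabilizer of every point of `Oᵢ` being `⟨ξ^{mᵢ}⟩`).  Let `Q(K) = P_S(K)/Δ(K^×)` with the
induced `𝒢`-action.  Then
`H¹(𝒢, Q(K)) ≅ (k^× ∩ ⋂ᵢ N_{K/K^⟨ξ^{mᵢ}⟩}(K^×)) / N_{K/k}(K^×)`. -/
theorem h1_projective_space_torus_cyclic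
    (k K : Type*) [Field k] [Field K] [Algebra k K] [FiniteDimensional k K] [IsGalois k K]
    (n : ℕ) (hn : 1 ≤ n) [MulAction (K ≃ₐ[k] K) (Fin (n + 1))]
    (d : ℕ) (ξ : K ≃ₐ[k] K) (hord : orderOf ξ = d)
    (hgen : ∀ g : K ≃ₐ[k] K, g ∈ Subgroup.zpowers ξ)
    {s : ℕ} (v : Fin s → Fin (n + 1)) (m : Fin s → ℕ)
    (hcover : ∀ x, ∃ i, x ∈ MulAction.orbit (K ≃ₐ[k] K) (v i))
    (hsep : ∀ i j, i ≠ j → v i ∉ MulAction.orbit (K ≃ₐ[k] K) (v j))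
    (hsize : ∀ i, Nat.card (MulAction.orbit (K ≃ₐ[k] K) (v i)) = m i)
    (hdvd : ∀ i, m i ∣ d)
    (hstab : ∀ i, MulAction.stabilizer (K ≃ₐ[k] K) (v i) = Subgroup.zpowers (ξ ^ (m i))) :
    Nonempty ((@H1 _ _ _ (QuotientGroup.Quotient.commGroup _) (quotAction k K (Fin (n + 1)))) ≃*
      (interNorms k K ξ m ⧸
        ((Units.map (Algebra.norm k : K →* k)).range).subgroupOf (interNorms k K ξ m))) := by
  classical
  have hinj : Function.Injective v := by
    intro i j hij
    by_contra hne
    exact hsep i j hne (hij ▸ MulAction.mem_orbit_self _)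
  let S := Fin (n + 1)
  let M := tripleGroup (k := k) (K := K) S ξ
  have hmem : ∀ x : M, x.1.2.2 ∈ interNorms k K ξ m := by
    rintro ⟨⟨c, f, l⟩, hx1, hx2⟩
    simp only [interNorms, Subgroup.mem_iInf]
    intro i
    rw [mem_normFromFixedField]
    obtain ⟨a, ha⟩ := pnorm_apply_stab f (v i) (Subgroup.zpowers (ξ ^ m i))
      (fun h hh => by rw [← hstab i] at hh; exact hh)
    refine ⟨a, ?_⟩
    rw [← ha]
    exact congrArg Units.val (congrFun hx2 (v i))
  let p1 : M →* H1 (qAct k K S) :=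
    (H1mk (qAct k K S)).comp ((MonoidHom.fst _ _).comp M.subtype)
  let p2 : M →* (interNorms k K ξ m ⧸
        ((Units.map (Algebra.norm k : K →* k)).range).subgroupOf (interNorms k K ξ m)) :=
    (QuotientGroup.mk' _).comp
      ((((MonoidHom.snd _ _).comp (MonoidHom.snd _ _)).comp M.subtype).codRestrict _ hmem)
  refine nonempty_equiv_of_ker_eq p1 p2 ?_ ?_ ?_
  · intro y
    obtain ⟨c, rfl⟩ := H1mk_surjective _ y
    obtain ⟨f, hf⟩ := QuotientGroup.mk_surjective (c.1 ξ)
    have h1 := cocycle_norm c.2 hgen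
    rw [← hf, mk_prod, mk_eq_one_iff] at h1
    obtain ⟨u, hu⟩ := h1
    obtain ⟨l, hl⟩ := pnorm_const_base hu
    exact ⟨⟨(c, f, l), hf.symm, hl⟩, rfl⟩
  · intro y
    obtain ⟨⟨l, hl⟩, rfl⟩ := QuotientGroup.mk_surjective y
    have hl' := hl
    simp only [interNorms, Subgroup.mem_iInf, mem_normFromFixedField] at hl'
    choose a ha using hl'
    let f : S → Kˣ := fun x => if h : ∃ i, v i = x then a h.choose else 1
    have hfv : ∀ i, f (v i) = a i := by
      intro i
      have hx : ∃ j, v j = v i := ⟨i, rfl⟩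
      simp only [f, dif_pos hx]
      rw [hinj hx.choose_spec]
    have hf1 : ∀ i (g : K ≃ₐ[k] K), g • v i ≠ v i → f (g • v i) = 1 := by
      intro i g hg
      refine dif_neg ?_
      rintro ⟨j, hj⟩
      by_cases hij : j = i
      · subst hij
        exact hg hj.symm
      · exact hsep j i hij (hj ▸ MulAction.mem_orbit _ _)
    have hN : pnorm k K S f = constHom K S (Units.map ((algebraMap k K) : k →* K) l) := by
      funext x
      obtain ⟨i, g, rfl⟩ := hcover x
      have h1 : ((pnorm k K S f (v i) : Kˣ) : K) = algebraMap k K l := by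
        rw [pnorm_extend _ (hstab i) (hf1 i), hfv, ha]
      ext
      have h2 := congrArg Units.val (congrFun (permTwist_pnorm (S := S) g f) (g • v i))
      rw [permTwist_apply, inv_smul_smul, h1, AlgEquiv.commutes] at h2
      exact h2.symm
    obtain ⟨c, hc, hcξ⟩ := exists_cocycle (qAct k K S) hgen (QuotientGroup.mk f)
      (by rw [mk_prod, mk_eq_one_iff]; exact ⟨_, hN.symm⟩)
    exact ⟨⟨(⟨c, hc⟩, f, l), hcξ, hN⟩, rfl⟩
  · ext ⟨⟨⟨c, hc⟩, f, l⟩, hx1, hx2⟩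
    have e1 : (⟨⟨⟨c, hc⟩, f, l⟩, hx1, hx2⟩ : M) ∈ p1.ker ↔
        c ∈ coboundaries (qAct k K S) :=
      H1mk_eq_one (qAct k K S) ⟨c, hc⟩
    have e2 : (⟨⟨⟨c, hc⟩, f, l⟩, hx1, hx2⟩ : M) ∈ p2.ker ↔
        l ∈ (Units.map (Algebra.norm k : K →* k)).range :=
      (QuotientGroup.eq_one_iff (⟨l, hmem ⟨⟨⟨c, hc⟩, f, l⟩, hx1, hx2⟩⟩ :
        interNorms k K ξ m)).trans Subgroup.mem_subgroupOf
    rw [e1, e2]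
    change c ξ = QuotientGroup.mk f at hx1
    change pnorm k K S f = constHom K S (Units.map ((algebraMap k K) : k →* K) l) at hx2
    constructor
    · rintro ⟨b, hb⟩
      obtain ⟨b, rfl⟩ := QuotientGroup.mk_surjective b
      have h1 : QuotientGroup.mk (b⁻¹ * permTwist k K S ξ b) =
          (QuotientGroup.mk f : (S → Kˣ) ⧸ constSubgroup K S) := by
        rw [← hx1, hb]
        rfl
      rw [QuotientGroup.eq] at h1
      obtain ⟨u, hu⟩ := h1
      change constHom K S u = _ at hu
      refine ⟨u, ?_⟩
      have h3 := pnorm_const (k := k) (S := S) u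
      rw [hu] at h3
      simp only [map_mul, map_inv, pnorm_permTwist, inv_mul_cancel, inv_one, one_mul, hx2] at h3
      have h4 := congrArg Units.val (constHom_inj h3)
      exact Units.ext ((algebraMap k K).injective h4.symm)
    · rintro ⟨u, hu⟩
      have h1 : pnorm k K S (f * (constHom K S u)⁻¹) = 1 := by
        rw [map_mul, map_inv, pnorm_const, hx2, hu, mul_inv_cancel]
      obtain ⟨c', hc', hcξ'⟩ := exists_cocycle (permTwist k K S) hgen _ h1
      obtain ⟨b, hb⟩ := perm_hilbert90 v hcover hsep c' hc'
      refine ⟨QuotientGroup.mk b, fun g => ?_⟩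
      have h5 := cocycle_ext hc (coboundary_mem (qAct k K S) (QuotientGroup.mk b)) hgen
        (by
          have h6 : QuotientGroup.mk (f * (constHom K S u)⁻¹) =
              (QuotientGroup.mk f : (S → Kˣ) ⧸ constSubgroup K S) := by
            rw [QuotientGroup.mk_mul_of_mem]
            exact inv_mem ⟨u, rfl⟩
          rw [hx1, ← h6, ← hcξ', hb]
          rfl)
      exact congrFun h5 g

end ArithToric
end
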